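/- Let P⃗ = (P_1,...,P_n) be an update sequence over At, S an answer set of P⃗, and S^◁ the corresponding answer set of the update program P⃗_◁. Then for every rule r occurring in P⃗, r ∈ Rej(S, P⃗) if and only if rej(r) ∈ S^◁. -/

import Mathlib

/-- A literal over atoms `α`: an atom or a strongly negated atom. -/
inductive Lit (α : Type) where
  | pos : α → Lit α
  | neg : α → Lit α

/-- The complementary literal. -/
def Lit.compl {α : Type} : Lit α → Lit α
  | .pos a => .neg a
  | .neg a => .pos a

/-- A rule of an extended logic program: optional head literal,
prerequisites `prem`, and weakly negated body literals `nbody`. -/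
structure Rule (α : Type) where
  head : Option (Lit α)
  prem : Set (Lit α)
  nbody : Set (Lit α)

/-- A set of literals is consistent iff it contains no complementary pair. -/
def Consistent {α : Type} (S : Set (Lit α)) : Prop :=
  ∀ a : α, ¬ (Lit.pos a ∈ S ∧ Lit.neg a ∈ S)

/-- The body of `r` is true in `S`. -/
def BodyTrue {α : Type} (S : Set (Lit α)) (r : Rule α) : Prop :=
  r.prem ⊆ S ∧ ∀ L ∈ r.nbody, L ∉ S

/-- The head of `r` is true in `S` (false for constraints). -/
def HeadTrue {α : Type} (S : Set (Lit α)) (r : Rule α) : Prop :=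
  ∃ L, r.head = some L ∧ L ∈ S

/-- Rule `r` is true in `S`. -/
def RuleTrue {α : Type} (S : Set (Lit α)) (r : Rule α) : Prop :=
  BodyTrue S r → HeadTrue S r

/-- `S` is a model of program `P`. -/
def IsModel {α : Type} (S : Set (Lit α)) (P : Set (Rule α)) : Prop :=
  ∀ r ∈ P, RuleTrue S r

/-- `r` is defeated by `S`. -/
def Defeated {α : Type} (S : Set (Lit α)) (r : Rule α) : Prop :=
  ∃ L ∈ r.nbody, L ∈ S

/-- The Gelfond–Lifschitz reduct of `P` relative to `S`. -/
def Reduct {α : Type} (P : Set (Rule α)) (S : Set (Lit α)) : Set (Rule α) :=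
  { r' | ∃ r ∈ P, ¬ Defeated S r ∧ r' = Rule.mk r.head r.prem ∅ }

/-- `S` is an answer set of `P`: a consistent set of literals that is a
minimal model of the reduct `P^S`. -/
def IsAnswerSet {α : Type} (P : Set (Rule α)) (S : Set (Lit α)) : Prop :=
  Consistent S ∧ IsModel S (Reduct P S) ∧
    ∀ T ⊆ S, IsModel T (Reduct P S) → T = S

/-- The belief set of `P`: all rules true in every answer set of `P`. -/
def Bel {α : Type} (P : Set (Rule α)) : Set (Rule α) :=
  { r | ∀ S, IsAnswerSet P S → RuleTrue S r }
/-- Extended alphabet `At*`: original atoms, indexed copies `A_i`,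
and rejection atoms `rej(r)` for (named copies of) rules. -/
inductive ExtAtom (α : Type) where
  | base : α → ExtAtom α
  | idx : ℕ → α → ExtAtom α
  | rej : ℕ → Rule α → ExtAtom α

/-- Lift a literal over `α` to the corresponding literal over `At*`. -/
def liftLit {α : Type} : Lit α → Lit (ExtAtom α)
  | .pos a => .pos (.base a)
  | .neg a => .neg (.base a)

/-- The indexed copy `L_i` of a literal `L`. -/
def idxLit {α : Type} (i : ℕ) : Lit α → Lit (ExtAtom α)
  | .pos a => .pos (.idx i a)
  | .neg a => .neg (.idx i a)

/-- Literal `L` occurs in the update sequence `(P 0, …, P (n-1))`. -/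
def OccursIn {α : Type} (n : ℕ) (P : ℕ → Set (Rule α)) (L : Lit α) : Prop :=
  ∃ i < n, ∃ r ∈ P i, r.head = some L ∨ L ∈ r.prem ∨ L ∈ r.nbody

/-- The update program `P_◁` of the update sequence `(P 0, …, P (n-1))`,
an ELP over the extended alphabet `At*`. -/
def UpdProgram {α : Type} (n : ℕ) (P : ℕ → Set (Rule α)) : Set (Rule (ExtAtom α)) :=
  -- (i) all constraints
  { r' | ∃ i < n, ∃ r ∈ P i, r.head = none ∧
      r' = Rule.mk none (liftLit '' r.prem) (liftLit '' r.nbody) } ∪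
  -- (ii)  L_i ← B(r), not rej(r)
  { r' | ∃ i < n, ∃ r ∈ P i, ∃ L, r.head = some L ∧
      r' = Rule.mk (some (idxLit i L)) (liftLit '' r.prem)
             ((liftLit '' r.nbody) ∪ {Lit.pos (ExtAtom.rej i r)}) } ∪
  -- (iii)  rej(r) ← B(r), ¬L_{i+1}
  { r' | ∃ i, i + 1 < n ∧ ∃ r ∈ P i, ∃ L, r.head = some L ∧
      r' = Rule.mk (some (Lit.pos (ExtAtom.rej i r)))
             ((liftLit '' r.prem) ∪ {idxLit (i+1) L.compl}) (liftLit '' r.nbody) } ∪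
  -- (iv) inertia rules  L_i ← L_{i+1}  and  L ← L_1
  { r' | ∃ L, OccursIn n P L ∧
      ((∃ i, i + 1 < n ∧ r' = Rule.mk (some (idxLit i L)) {idxLit (i+1) L} ∅) ∨
        r' = Rule.mk (some (liftLit L)) {idxLit 0 L} ∅) }

/-- `S` is an update answer set of the sequence `(P 0, …, P (n-1))`:
the restriction to `Lit_At` of an answer set of the update program. -/
def UpdateAnswerSet {α : Type} (n : ℕ) (P : ℕ → Set (Rule α)) (S : Set (Lit α)) : Prop :=
  ∃ S' : Set (Lit (ExtAtom α)), IsAnswerSet (UpdProgram n P) S' ∧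
    S = { L | liftLit L ∈ S' }

/-- Two rules are conflicting iff their heads are complementary literals. -/
def Conflicting {α : Type} (r r' : Rule α) : Prop :=
  ∃ L, r.head = some L ∧ r'.head = some L.compl

/-- The founded rejection set at level `i`: rules of `P i` rejected by a
conflicting, itself non-rejected rule of some later program. -/
def RejLevel {α : Type} (n : ℕ) (P : ℕ → Set (Rule α)) (S : Set (Lit α)) (i : ℕ) :
    Set (Rule α) :=
  { r | r ∈ P i ∧ ∃ j, ∃ _ : i < j, ∃ _ : j < n, ∃ r',
      r' ∈ P j ∧ r' ∉ RejLevel n P S j ∧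
      Conflicting r r' ∧ BodyTrue S r ∧ BodyTrue S r' }
  termination_by n - i
  decreasing_by omega

/-- The founded rejection set `Rej(S, P⃗)`. -/
def Rej {α : Type} (n : ℕ) (P : ℕ → Set (Rule α)) (S : Set (Lit α)) : Set (Rule α) :=
  { r | ∃ i < n, r ∈ RejLevel n P S i }

/-- The union `∪P⃗` of all rules of the sequence. -/
def UnionSeq {α : Type} (n : ℕ) (P : ℕ → Set (Rule α)) : Set (Rule α) :=
  { r | ∃ i < n, r ∈ P i }

theorem aux_support {β : Type} {Q : Set (Rule β)} {S : Set (Lit β)} (h : IsAnswerSet Q S)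
    {L : Lit β} (hL : L ∈ S) : ∃ r ∈ Q, r.head = some L ∧ BodyTrue S r := by
  by_contra hc
  have hT : S \ {L} = S := by
    apply h.2.2 _ Set.diff_subset
    rintro _ ⟨r, hr, hd, rfl⟩ hb
    have hpS : r.prem ⊆ S := fun x hx => (hb.1 hx).1
    obtain ⟨M, hM, hMS⟩ := h.2.1 _ ⟨r, hr, hd, rfl⟩ ⟨hpS, fun _ hx => hx.elim⟩
    refine ⟨M, hM, hMS, ?_⟩
    rintro rfl
    exact hc ⟨r, hr, hM, hpS, fun x hx hxS => hd ⟨x, hx, hxS⟩⟩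
  rw [← hT] at hL
  exact hL.2 rfl

theorem aux_fire {β : Type} {Q : Set (Rule β)} {S : Set (Lit β)} (h : IsAnswerSet Q S)
    {r : Rule β} (hr : r ∈ Q) {L : Lit β} (hL : r.head = some L) (hb : BodyTrue S r) : L ∈ S := by
  obtain ⟨M, hM, hMS⟩ := h.2.1 _ ⟨r, hr, fun ⟨x, hx, hxS⟩ => hb.2 x hx hxS, rfl⟩
    ⟨hb.1, fun _ hx => hx.elim⟩
  have hM' : r.head = some M := hM
  rw [hL] at hM'
  cases hM'
  exact hMS

theorem aux_idx_inj {α : Type} {i j : ℕ} {L M : Lit α} (h : idxLit i L = idxLit j M) :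
    i = j ∧ L = M := by
  cases L <;> cases M <;> simp_all [idxLit]

theorem aux_idx_lift {α : Type} {i : ℕ} {L M : Lit α} (h : liftLit M = idxLit i L) : False := by
  cases L <;> cases M <;> simp_all [idxLit, liftLit]

theorem aux_idx_rej {α : Type} {i j : ℕ} {r : Rule α} {L : Lit α}
    (h : idxLit i L = Lit.pos (ExtAtom.rej j r)) : False := by
  cases L <;> simp_all [idxLit]

theorem aux_lift_rej {α : Type} {j : ℕ} {r : Rule α} {L : Lit α}
    (h : liftLit L = Lit.pos (ExtAtom.rej j r)) : False := by
  cases L <;> simp_all [liftLit]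

theorem aux_idx_support {α : Type} {n : ℕ} {P : ℕ → Set (Rule α)}
    {S' : Set (Lit (ExtAtom α))} (hS' : IsAnswerSet (UpdProgram n P) S') (L : Lit α) :
    ∀ d j, n - j = d → idxLit j L ∈ S' →
      ∃ k, j ≤ k ∧ k < n ∧ ∃ r ∈ P k, r.head = some L ∧
        BodyTrue { L | liftLit L ∈ S' } r ∧ Lit.pos (ExtAtom.rej k r) ∉ S' := by
  intro d
  induction d with
  | zero =>
    intro j hj hm
    obtain ⟨q, hq, hh, hb⟩ := aux_support hS' hm
    rcases hq with ((⟨i, hi, r, hr, hn, rfl⟩ | ⟨i, hi, r, hr, M, hM, rfl⟩) |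
      ⟨i, hi, r, hr, M, hM, rfl⟩) | ⟨M, hM, ⟨i, hi, rfl⟩ | rfl⟩
    · cases hh
    · have := (aux_idx_inj (Option.some.inj hh)).1
      omega
    · exact (aux_idx_rej (Option.some.inj hh).symm).elim
    · have := (aux_idx_inj (Option.some.inj hh)).1
      omega
    · exact (aux_idx_lift (Option.some.inj hh)).elim
  | succ d ih =>
    intro j hj hm
    obtain ⟨q, hq, hh, hb⟩ := aux_support hS' hm
    rcases hq with ((⟨i, hi, r, hr, hn, rfl⟩ | ⟨i, hi, r, hr, M, hM, rfl⟩) |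
      ⟨i, hi, r, hr, M, hM, rfl⟩) | ⟨M, hM, ⟨i, hi, rfl⟩ | rfl⟩
    · cases hh
    · obtain ⟨rfl, rfl⟩ := aux_idx_inj (Option.some.inj hh)
      exact ⟨i, le_rfl, hi, r, hr, hM,
        ⟨fun x hx => hb.1 ⟨x, hx, rfl⟩, fun x hx => hb.2 _ (Or.inl ⟨x, hx, rfl⟩)⟩,
        hb.2 _ (Or.inr rfl)⟩
    · exact (aux_idx_rej (Option.some.inj hh).symm).elim
    · obtain ⟨rfl, rfl⟩ := aux_idx_inj (Option.some.inj hh)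
      obtain ⟨k, hk, h⟩ := ih (i + 1) (by omega) (hb.1 rfl)
      exact ⟨k, by omega, h⟩
    · exact (aux_idx_lift (Option.some.inj hh)).elim

theorem aux_inertia {α : Type} {n : ℕ} {P : ℕ → Set (Rule α)}
    {S' : Set (Lit (ExtAtom α))} (hS' : IsAnswerSet (UpdProgram n P) S') {L : Lit α}
    (hL : OccursIn n P L) (i : ℕ) :
    ∀ d, i + d < n → idxLit (i + d) L ∈ S' → idxLit i L ∈ S' := by
  intro d
  induction d with
  | zero => exact fun _ h => h
  | succ d ih =>
    intro hd h
    apply ih (by omega)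
    refine aux_fire hS' (r := Rule.mk (some (idxLit (i + d) L)) {idxLit (i + d + 1) L} ∅)
      (Or.inr ⟨L, hL, Or.inl ⟨i + d, by omega, rfl⟩⟩) rfl ⟨?_, fun _ hx => hx.elim⟩
    rintro _ rfl
    exact h

theorem aux_main {α : Type} (n : ℕ) (P : ℕ → Set (Rule α))
    (S' : Set (Lit (ExtAtom α)))
    (hS' : IsAnswerSet (UpdProgram n P) S') :
    ∀ d i, n - i = d → i < n → ∀ r ∈ P i,
      (r ∈ RejLevel n P { L | liftLit L ∈ S' } i ↔ Lit.pos (ExtAtom.rej i r) ∈ S') := by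
  intro d
  induction d using Nat.strong_induction_on with
  | _ d ih =>
  intro i hd hi r hr
  rw [RejLevel]
  constructor
  · rintro ⟨-, j, hij, hj, r', hr', hnr, ⟨L, hL, hL'⟩, hb, hb'⟩
    rw [ih (n - j) (by omega) j rfl hj r' hr'] at hnr
    have h1 : idxLit j L.compl ∈ S' := by
      refine aux_fire hS' (r := Rule.mk (some (idxLit j L.compl)) (liftLit '' r'.prem)
             ((liftLit '' r'.nbody) ∪ {Lit.pos (ExtAtom.rej j r')}))
        (Or.inl (Or.inl (Or.inr ⟨j, hj, r', hr', _, hL', rfl⟩))) rfl ⟨?_, ?_⟩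
      · rintro _ ⟨x, hx, rfl⟩
        exact hb'.1 hx
      · rintro _ (⟨x, hx, rfl⟩ | rfl)
        · exact hb'.2 x hx
        · exact hnr
    obtain ⟨e, rfl⟩ := Nat.exists_eq_add_of_le (show i + 1 ≤ j from hij)
    have h2 := aux_inertia hS' ⟨_, hj, r', hr', Or.inl hL'⟩ (i + 1) e hj h1
    refine aux_fire hS' (r := Rule.mk (some (Lit.pos (ExtAtom.rej i r)))
             ((liftLit '' r.prem) ∪ {idxLit (i+1) L.compl}) (liftLit '' r.nbody))
      (Or.inl (Or.inr ⟨i, by omega, r, hr, L, hL, rfl⟩)) rfl ⟨?_, ?_⟩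
    · rintro _ (⟨x, hx, rfl⟩ | rfl)
      · exact hb.1 hx
      · exact h2
    · rintro _ ⟨x, hx, rfl⟩
      exact hb.2 x hx
  · intro hm
    obtain ⟨q, hq, hh, hb⟩ := aux_support hS' hm
    rcases hq with ((⟨i', hi', r', hr', hn, rfl⟩ | ⟨i', hi', r', hr', M, hM, rfl⟩) |
      ⟨i', hi', r', hr', M, hM, rfl⟩) | ⟨M, hM, ⟨i', hi', rfl⟩ | rfl⟩
    · cases hh
    · exact (aux_idx_rej (Option.some.inj hh)).elim
    · cases hh
      obtain ⟨k, hk, hkn, r', hr', hh', hb', hrej⟩ :=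
        aux_idx_support hS' M.compl _ (i + 1) rfl (hb.1 (Or.inr rfl))
      refine ⟨hr, k, hk, hkn, r', hr', ?_, ⟨M, hM, hh'⟩,
        ⟨fun x hx => hb.1 (Or.inl ⟨x, hx, rfl⟩), fun x hx => hb.2 _ ⟨x, hx, rfl⟩⟩, hb'⟩
      rwa [ih (n - k) (by omega) k rfl hkn r' hr']
    · exact (aux_idx_rej (Option.some.inj hh)).elim
    · exact (aux_lift_rej (Option.some.inj hh)).elim

/-- a rule is in the rejection set iff its rejection atom is
in the corresponding answer set of the update program. -/
theorem rej_iff_rej_atom {α : Type} (n : ℕ) (P : ℕ → Set (Rule α))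
    (S : Set (Lit α)) (S' : Set (Lit (ExtAtom α)))
    (hS' : IsAnswerSet (UpdProgram n P) S')
    (hres : S = { L | liftLit L ∈ S' })
    (i : ℕ) (hi : i < n) (r : Rule α) (hr : r ∈ P i) :
    r ∈ RejLevel n P S i ↔ Lit.pos (ExtAtom.rej i r) ∈ S' := by
  subst hres
  exact aux_main n P S' hS' _ i rfl hi r hr
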